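/- Let A = {α(0),…,α(k),β} ∈ 𝒜_n with barycentric coordinates λ_0,…,λ_k > 0 of β (i.e. β = Σ_{i=0}^k λ_i α(i), Σ_{i=0}^k λ_i = 1). For f = Σ_{α∈A} f_α x^α with f_{α(0)} ≥ 0,…,f_{α(k)} ≥ 0, let Θ_f = Π_{i=0}^k (f_{α(i)}/λ_i)^{λ_i} be the circuit number. Then: if β ∈ (2ℤ₊)ⁿ, P_{n,A} = { f = Σ_{α∈A} f_α x^α : f_{α(0)} ≥ 0,…,f_{α(k)} ≥ 0, f_β ≥ −Θ_f }; and if β ∉ (2ℤ₊)ⁿ, P_{n,A} = { f = Σ_{α∈A} f_α x^α : f_{α(0)} ≥ 0,…,f_{α(k)} ≥ 0, −Θ_f ≤ f_β ≤ Θ_f }. -/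

import Mathlib

open MvPolynomial

/-- The cone of `m`-tuples of `k × k` real positive semidefinite matrices, `(𝒮₊ᵏ)^m`. -/
def PSDTuple (k m : ℕ) : Set (Fin m → Matrix (Fin k) (Fin k) ℝ) :=
  {A | ∀ i, (A i).PosSemidef}

/-- The cone `𝒮₊ᵏ` of `k × k` real positive semidefinite matrices. -/
def PSDCone (k : ℕ) : Set (Matrix (Fin k) (Fin k) ℝ) :=
  {A | A.PosSemidef}

/-- `S ⊆ V` has a `K`-lift if `S = π(K ∩ H)` for an affine subspace `H` and a linear map `π`. -/
def HasLift {W V : Type*} [AddCommGroup W] [Module ℝ W] [AddCommGroup V] [Module ℝ V]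
    (K : Set W) (S : Set V) : Prop :=
  ∃ (H : AffineSubspace ℝ W) (p : W →ₗ[ℝ] V), S = p '' (K ∩ (H : Set W))

/-- Semidefinite extension degree: the smallest `k` such that `S` has an `(𝒮₊ᵏ)^m`-lift
for some finite `m` (`⊤` if there is no such `k`). -/
noncomputable def sxdeg {V : Type*} [AddCommGroup V] [Module ℝ V] (S : Set V) : ℕ∞ :=
  sInf {c : ℕ∞ | ∃ k m : ℕ, c = (k : ℕ∞) ∧ HasLift (PSDTuple k m) S}

/-- Semidefinite extension complexity: the smallest `k` such that `S` has an `𝒮₊ᵏ`-lift. -/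
noncomputable def sxc {V : Type*} [AddCommGroup V] [Module ℝ V] (S : Set V) : ℕ∞ :=
  sInf {c : ℕ∞ | ∃ k : ℕ, c = (k : ℕ∞) ∧ HasLift (PSDCone k) S}

/-- Coefficient embedding of polynomials into the product space `(Fin n →₀ ℕ) → ℝ`;
used to express topological notions (closedness) for sets of polynomials. -/
noncomputable def coeffMap (n : ℕ) : MvPolynomial (Fin n) ℝ →ₗ[ℝ] ((Fin n →₀ ℕ) → ℝ) where
  toFun f := fun a => coeff a f
  map_add' := by intros; funext; simp
  map_smul' := by intros; funext; simp

/-- `Σ_{n,2d}`: sums of squares of polynomials, of degree at most `2d`, in `n` variables. -/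
def SOSCone (n d : ℕ) : Set (MvPolynomial (Fin n) ℝ) :=
  {f | f.totalDegree ≤ 2 * d ∧
    ∃ (r : ℕ) (g : Fin r → MvPolynomial (Fin n) ℝ), f = ∑ i, g i ^ 2}

/-- `P_{n,2d}(X)`: polynomials of degree at most `2d` that are nonnegative on `X`. -/
def PosCone (n d : ℕ) (X : Set (Fin n → ℝ)) : Set (MvPolynomial (Fin n) ℝ) :=
  {f | f.totalDegree ≤ 2 * d ∧ ∀ x ∈ X, 0 ≤ MvPolynomial.eval x f}

/-- The vector `v_{n,d}(x) = (x^α)_{|α| ≤ d}` of all monomials of degree at most `d`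
evaluated at `x`, regarded inside the coordinate space `(Fin n →₀ ℕ) → ℝ`. -/
noncomputable def monVec (n d : ℕ) (x : Fin n → ℝ) : (Fin n →₀ ℕ) → ℝ :=
  fun a => if (a.sum fun _ e => e) ≤ d then ∏ i, x i ^ a i else 0

/-- The convex conic hull: all finite nonnegative combinations of elements of `s`. -/
def coneHull {V : Type*} [AddCommGroup V] [Module ℝ V] (s : Set V) : Set V :=
  {y | ∃ (r : ℕ) (c : Fin r → ℝ) (v : Fin r → V),
    (∀ i, 0 ≤ c i) ∧ (∀ i, v i ∈ s) ∧ y = ∑ i, c i • v i}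

/-- `P_{n,A}`: the cone of nonnegative polynomials whose support is contained in `A`. -/
def SuppCone (n : ℕ) (A : Finset (Fin n →₀ ℕ)) : Set (MvPolynomial (Fin n) ℝ) :=
  {f | f.support ⊆ A ∧ ∀ x : Fin n → ℝ, 0 ≤ MvPolynomial.eval x f}

/-- `A ∈ 𝒜_n`: `A = {α(0),…,α(k),β}` where `α(0),…,α(k) ∈ (2ℤ₊)ⁿ` are the vertices of a
`k`-dimensional simplex (`1 ≤ k ≤ n`) and `β` lies in its relative interior. -/
def IsCircuit (n : ℕ) (A : Finset (Fin n →₀ ℕ)) : Prop :=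
  ∃ (k : ℕ) (α : Fin (k + 1) → (Fin n →₀ ℕ)) (β : Fin n →₀ ℕ) (lam : Fin (k + 1) → ℝ),
    1 ≤ k ∧ k ≤ n ∧
    (∀ i j, Even (α i j)) ∧
    AffineIndependent ℝ (fun i => ((fun j => (α i j : ℝ)) : Fin n → ℝ)) ∧
    (∀ i, 0 < lam i) ∧ (∑ i, lam i) = 1 ∧
    (∀ j, (β j : ℝ) = ∑ i, lam i * (α i j : ℝ)) ∧
    β ∉ Set.range α ∧
    A = insert β (Finset.image α Finset.univ)

/-- The SONC cone `C_{n,2d} = Σ_{A ∈ 𝒜_{n,2d}} P_{n,A}`. -/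
def SONCCone (n d : ℕ) : Set (MvPolynomial (Fin n) ℝ) :=
  {f | ∃ (r : ℕ) (g : Fin r → MvPolynomial (Fin n) ℝ),
    (∀ i, ∃ A : Finset (Fin n →₀ ℕ), IsCircuit n A ∧
      (∀ a ∈ A, (a.sum fun _ e => e) ≤ 2 * d) ∧ g i ∈ SuppCone n A) ∧
    f = ∑ i, g i}

/-- An affinely independent family can be mapped to arbitrary values, up to a common shift, by a
linear functional. -/
theorem AffineIndependent.exists_linearMap_eq_add {ι K V : Type*} [Field K] [AddCommGroup V]
    [Module K V] {p : ι → V} (hp : AffineIndependent K p) (i₀ : ι) (t : ι → K) :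
    ∃ (φ : V →ₗ[K] K) (s : K), ∀ i, φ (p i) = t i + s := by
  have hli := (affineIndependent_iff_linearIndependent_vsub K p i₀).1 hp
  obtain ⟨φ, hφ⟩ := LinearMap.exists_extend
    ((Module.Basis.span hli).constr K fun i : {x // x ≠ i₀} => t i - t i₀)
  refine ⟨φ, φ (p i₀) - t i₀, fun i => ?_⟩
  by_cases hi : i = i₀
  · subst hi; ring
  · have h := (Module.Basis.span hli).constr_basis K (fun i : {x // x ≠ i₀} => t i - t i₀) ⟨i, hi⟩
    rw [← hφ, LinearMap.comp_apply, Submodule.subtype_apply, Module.Basis.span_apply] at h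
    change φ (p i - p i₀) = t i - t i₀ at h
    rw [map_sub] at h
    linear_combination h

/-- The monomial `|x|^β` is the weighted geometric mean of the monomials `|x|^(α i)`. -/
theorem prod_prod_abs_pow_rpow {ι κ : Type*} [Fintype ι] [Fintype κ] {α : ι → κ → ℕ} {β : κ → ℕ}
    {lam : ι → ℝ} (hlam : ∀ i, 0 ≤ lam i) (hβ : ∀ j, (β j : ℝ) = ∑ i, lam i * (α i j : ℝ))
    (x : κ → ℝ) :
    ∏ i, (∏ j, |x j| ^ α i j) ^ lam i = ∏ j, |x j| ^ β j := by
  have h (i : ι) : (∏ j, |x j| ^ α i j) ^ lam i = ∏ j, |x j| ^ (lam i * (α i j : ℝ)) := by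
    rw [← Real.finsetProd_rpow _ _ fun j _ => by positivity]
    refine Finset.prod_congr rfl fun j _ => ?_
    rw [mul_comm, Real.rpow_mul (abs_nonneg _), Real.rpow_natCast]
  simp_rw [h]
  rw [Finset.prod_comm]
  refine Finset.prod_congr rfl fun j _ => ?_
  rw [← Real.rpow_sum_of_nonneg (abs_nonneg _) fun i _ => mul_nonneg (hlam i) (Nat.cast_nonneg _),
    ← hβ, Real.rpow_natCast]

/-- Weighted AM-GM with the constant given by the circuit number. -/
theorem prod_div_rpow_mul_prod_rpow_le_sum {ι : Type*} [Fintype ι] {c lam u : ι → ℝ}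
    (hlam : ∀ i, 0 < lam i) (hsum : ∑ i, lam i = 1) (hc : ∀ i, 0 ≤ c i) (hu : ∀ i, 0 ≤ u i) :
    (∏ i, (c i / lam i) ^ lam i) * ∏ i, u i ^ lam i ≤ ∑ i, c i * u i := by
  have hd (i : ι) : 0 ≤ c i / lam i := div_nonneg (hc i) (hlam i).le
  have h := Real.geom_mean_le_arith_mean_weighted Finset.univ lam (fun i => c i / lam i * u i)
    (fun i _ => (hlam i).le) hsum fun i _ => mul_nonneg (hd i) (hu i)
  simp_rw [Real.mul_rpow (hd _) (hu _), Finset.prod_mul_distrib] at h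
  refine h.trans_eq (Finset.sum_congr rfl fun i _ => ?_)
  have := (hlam i).ne'
  field_simp

theorem continuous_sum_add_mul_prod_rpow {ι : Type*} [Fintype ι] (c : ι → ℝ) {lam : ι → ℝ}
    (b : ℝ) (hlam : ∀ i, 0 < lam i) :
    Continuous fun u : ι → ℝ => ∑ i, c i * u i + b * ∏ i, u i ^ lam i := by
  have h : Continuous fun u : ι → ℝ => ∏ i, u i ^ lam i :=
    continuous_finsetProd _ fun i _ =>
      (continuous_apply i).rpow_const fun _ => Or.inr (hlam i).le
  fun_prop

/-- If `∑ c i * u i + b * ∏ u i ^ lam i` is nonnegative on the positive orthant, then so it is on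
its closure. -/
theorem sum_add_mul_prod_rpow_nonneg_of_nonneg {ι : Type*} [Fintype ι] {c lam : ι → ℝ} {b : ℝ}
    (hlam : ∀ i, 0 < lam i)
    (h : ∀ u : ι → ℝ, (∀ i, 0 < u i) → 0 ≤ ∑ i, c i * u i + b * ∏ i, u i ^ lam i)
    (u : ι → ℝ) (hu : ∀ i, 0 ≤ u i) : 0 ≤ ∑ i, c i * u i + b * ∏ i, u i ^ lam i := by
  have hcont := (continuous_sum_add_mul_prod_rpow c b hlam).comp
    (show Continuous fun ε : ℝ => fun i => u i + ε by fun_prop)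
  have hlim := (hcont.tendsto 0).mono_left (nhdsWithin_le_nhds (s := Set.Ioi 0))
  simp only [Function.comp_def, add_zero] at hlim
  refine ge_of_tendsto hlim ?_
  filter_upwards [self_mem_nhdsWithin] with ε hε
  exact h _ fun i => add_pos_of_nonneg_of_pos (hu i) hε

theorem coeff_nonneg_of_sum_add_mul_prod_rpow_nonneg {ι : Type*} [Fintype ι] [Nontrivial ι]
    {c lam : ι → ℝ} {b : ℝ} (hlam : ∀ i, 0 < lam i)
    (h : ∀ u : ι → ℝ, (∀ i, 0 < u i) → 0 ≤ ∑ i, c i * u i + b * ∏ i, u i ^ lam i) (i : ι) :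
    0 ≤ c i := by
  classical
  obtain ⟨j, hj⟩ := exists_ne i
  have h' := sum_add_mul_prod_rpow_nonneg_of_nonneg hlam h (Pi.single i 1) fun l => by
    rcases eq_or_ne l i with rfl | hl <;> simp [*]
  have hprod : ∏ l, (Pi.single i 1 : ι → ℝ) l ^ lam l = 0 :=
    Finset.prod_eq_zero (Finset.mem_univ j) (by simp [hj, (hlam j).ne'])
  rw [hprod, mul_zero, add_zero] at h'
  simpa [Pi.single_apply] using h'

/-- If `∑ c i * u i + b * ∏ u i ^ lam i` is nonnegative on the positive orthant, then `b` is bounded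
below by minus the circuit number. -/
theorem neg_prod_div_rpow_le {ι : Type*} [Fintype ι] {c lam : ι → ℝ} {b : ℝ}
    (hlam : ∀ i, 0 < lam i) (hsum : ∑ i, lam i = 1) (hc : ∀ i, 0 ≤ c i)
    (h : ∀ u : ι → ℝ, (∀ i, 0 < u i) → 0 ≤ ∑ i, c i * u i + b * ∏ i, u i ^ lam i) :
    -(∏ i, (c i / lam i) ^ lam i) ≤ b := by
  have hcont : Continuous fun ε : ℝ => -(∏ i, ((c i + ε) / lam i) ^ lam i) :=
    (continuous_finsetProd _ fun i _ => (by fun_prop : Continuous fun ε : ℝ =>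
      (c i + ε) / lam i).rpow_const fun _ => Or.inr (hlam i).le).neg
  have hlim := (hcont.tendsto 0).mono_left (nhdsWithin_le_nhds (s := Set.Ioi 0))
  simp only [add_zero] at hlim
  refine le_of_tendsto hlim ?_
  filter_upwards [self_mem_nhdsWithin] with ε (hε : 0 < ε)
  have hcε (i : ι) : 0 < c i + ε := add_pos_of_nonneg_of_pos (hc i) hε
  have hd (i : ι) : 0 < (c i + ε) / lam i := div_pos (hcε i) (hlam i)
  have hu (i : ι) : 0 < ((c i + ε) / lam i)⁻¹ := inv_pos.2 (hd i)
  have h' := h _ hu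
  have hle : ∑ i, c i * ((c i + ε) / lam i)⁻¹ ≤ 1 := by
    rw [← hsum]
    refine Finset.sum_le_sum fun i _ => ?_
    rw [inv_div, mul_div_assoc', div_le_iff₀ (hcε i)]
    nlinarith [hlam i]
  simp_rw [Real.inv_rpow (hd _).le, Finset.prod_inv_distrib] at h'
  have hP : 0 < ∏ i, ((c i + ε) / lam i) ^ lam i :=
    Finset.prod_pos fun i _ => Real.rpow_pos_of_pos (hd i) _
  have h1 : 0 ≤ 1 + b * (∏ i, ((c i + ε) / lam i) ^ lam i)⁻¹ := by linarith
  have h2 := mul_nonneg h1 hP.le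
  rw [add_mul, mul_assoc, inv_mul_cancel₀ hP.ne'] at h2
  linarith

/-- Evaluation of a polynomial supported in `{α i} ∪ {β}`. -/
theorem MvPolynomial.eval_eq_sum_add_of_support_subset {σ ι R : Type*} [Fintype σ] [Fintype ι]
    [DecidableEq σ] [CommSemiring R] {α : ι → σ →₀ ℕ} {β : σ →₀ ℕ} (hα : Function.Injective α)
    (hβ : β ∉ Set.range α) {f : MvPolynomial σ R}
    (hf : f.support ⊆ insert β (Finset.image α Finset.univ)) (x : σ → R) :
    eval x f = ∑ i, coeff (α i) f * ∏ j, x j ^ α i j + coeff β f * ∏ j, x j ^ β j := by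
  rw [eval_eq', Finset.sum_subset hf fun a _ ha => by rw [notMem_support_iff.1 ha, zero_mul],
    Finset.sum_insert (by simpa using hβ), Finset.sum_image fun _ _ _ _ h => hα h, add_comm]

/-- For affinely independent exponents, nonnegativity of a circuit polynomial on the positive
orthant does not depend on the exponents but only on the barycentric coordinates. -/
theorem AffineIndependent.sum_add_mul_prod_rpow_nonneg {ι κ : Type*} [Fintype ι] [Nonempty ι]
    [Fintype κ] {α : ι → κ → ℕ} {β : κ → ℕ} {lam c : ι → ℝ} {b : ℝ}
    (haff : AffineIndependent ℝ fun i => (fun j => (α i j : ℝ) : κ → ℝ))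
    (hsum : ∑ i, lam i = 1) (hβ : ∀ j, (β j : ℝ) = ∑ i, lam i * (α i j : ℝ))
    (h : ∀ x : κ → ℝ, (∀ j, 0 < x j) →
      0 ≤ ∑ i, c i * ∏ j, x j ^ α i j + b * ∏ j, x j ^ β j)
    (u : ι → ℝ) (hu : ∀ i, 0 < u i) : 0 ≤ ∑ i, c i * u i + b * ∏ i, u i ^ lam i := by
  classical
  obtain ⟨φ, s, hφ⟩ := haff.exists_linearMap_eq_add (Classical.arbitrary ι) fun i => Real.log (u i)
  have hmon (γ : κ → ℕ) : ∏ j, Real.exp (φ (Pi.single j 1)) ^ γ j =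
      Real.exp (φ fun j => (γ j : ℝ)) := by
    simp_rw [← Real.exp_nat_mul, ← Real.exp_sum]
    rw [LinearMap.pi_apply_eq_sum_univ φ fun j => (γ j : ℝ)]
    have hsingle (j : κ) : (Pi.single j 1 : κ → ℝ) = fun i => if j = i then 1 else 0 := by
      ext i; simp [Pi.single_apply, eq_comm]
    simp_rw [hsingle, smul_eq_mul]
  have hφβ : φ (fun j => (β j : ℝ)) = ∑ i, Real.log (u i) * lam i + s := by
    have : (fun j => (β j : ℝ)) = ∑ i, lam i • (fun j => (α i j : ℝ) : κ → ℝ) := by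
      ext j; simp [hβ]
    rw [this, map_sum]
    simp_rw [map_smul, hφ, smul_eq_mul, mul_add, Finset.sum_add_distrib, ← Finset.sum_mul, hsum,
      one_mul, mul_comm]
  have h' := h (fun j => Real.exp (φ (Pi.single j 1))) fun j => Real.exp_pos _
  simp_rw [hmon, hφ, hφβ, Real.exp_add, Real.exp_log (hu _), Real.exp_sum, ← mul_assoc,
    ← Finset.sum_mul, ← Real.rpow_def_of_pos (hu _)] at h'
  rw [← add_mul] at h'
  exact nonneg_of_mul_nonneg_left h' (Real.exp_pos s)

/-- Flipping the sign of one variable. -/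
theorem prod_update_neg_pow {κ R : Type*} [Fintype κ] [DecidableEq κ] [CommRing R] (x : κ → R)
    (γ : κ → ℕ) (j₀ : κ) :
    ∏ j, Function.update x j₀ (-x j₀) j ^ γ j = (-1) ^ γ j₀ * ∏ j, x j ^ γ j := by
  rw [← Finset.mul_prod_erase _ _ (Finset.mem_univ j₀),
    ← Finset.mul_prod_erase _ (fun j => x j ^ γ j) (Finset.mem_univ j₀), Function.update_self,
    neg_pow, mul_assoc]
  congr 2
  exact Finset.prod_congr rfl fun j hj => by
    rw [Function.update_of_ne (Finset.ne_of_mem_erase hj)]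

/-- Lemma 6.3: explicit description of the cone `P_{n,A}` for a circuit
`A = {α(0),…,α(k),β} ∈ 𝒜_n`, in terms of the circuit number
`Θ_f = Π_i (f_{α(i)}/λ_i)^{λ_i}` (real powers). -/
theorem stmt_17 (n k : ℕ) (hk1 : 1 ≤ k) (hkn : k ≤ n)
    (α : Fin (k + 1) → (Fin n →₀ ℕ)) (β : Fin n →₀ ℕ) (lam : Fin (k + 1) → ℝ)
    (hαinj : Function.Injective α)
    (heven : ∀ i j, Even (α i j))
    (haff : AffineIndependent ℝ (fun i => ((fun j => (α i j : ℝ)) : Fin n → ℝ)))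
    (hlam : ∀ i, 0 < lam i) (hsum : (∑ i, lam i) = 1)
    (hβ : ∀ j, (β j : ℝ) = ∑ i, lam i * (α i j : ℝ))
    (hβnot : β ∉ Set.range α)
    (A : Finset (Fin n →₀ ℕ)) (hA : A = insert β (Finset.image α Finset.univ)) :
    ((∀ j, Even (β j)) → SuppCone n A =
      {f | f.support ⊆ A ∧ (∀ i, 0 ≤ coeff (α i) f) ∧
        -(∏ i, (coeff (α i) f / lam i) ^ (lam i)) ≤ coeff β f}) ∧
    ((¬ ∀ j, Even (β j)) → SuppCone n A =
      {f | f.support ⊆ A ∧ (∀ i, 0 ≤ coeff (α i) f) ∧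
        -(∏ i, (coeff (α i) f / lam i) ^ (lam i)) ≤ coeff β f ∧
        coeff β f ≤ ∏ i, (coeff (α i) f / lam i) ^ (lam i)}) := by
  have : Nontrivial (Fin (k + 1)) := Fin.nontrivial_iff_two_le.2 (by lia)
  subst hA
  have hev {f : MvPolynomial (Fin n) ℝ} := eval_eq_sum_add_of_support_subset (f := f) hαinj hβnot
  have heq (x : Fin n → ℝ) (i : Fin (k + 1)) : ∏ j, x j ^ α i j = ∏ j, |x j| ^ α i j :=
    Finset.prod_congr rfl fun j _ => ((heven i j).pow_abs _).symm
  have habs (x : Fin n → ℝ) : |∏ j, x j ^ β j| = ∏ j, |x j| ^ β j := by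
    simp_rw [Finset.abs_prod, abs_pow]
  have hamgm {f : MvPolynomial (Fin n) ℝ} (hc : ∀ i, 0 ≤ coeff (α i) f) (x : Fin n → ℝ) :
      (∏ i, (coeff (α i) f / lam i) ^ lam i) * |∏ j, x j ^ β j| ≤
        ∑ i, coeff (α i) f * ∏ j, x j ^ α i j := by
    rw [habs, ← prod_prod_abs_pow_rpow (α := fun i j => α i j) (fun i => (hlam i).le) hβ]
    exact (prod_div_rpow_mul_prod_rpow_le_sum hlam hsum hc fun i => by positivity).trans_eq
      (Finset.sum_congr rfl fun i _ => by rw [heq x i])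
  have hnec {f : MvPolynomial (Fin n) ℝ}
      (hf : f ∈ SuppCone n (insert β (Finset.image α Finset.univ))) :
      (∀ i, 0 ≤ coeff (α i) f) ∧ -(∏ i, (coeff (α i) f / lam i) ^ lam i) ≤ coeff β f := by
    have h := haff.sum_add_mul_prod_rpow_nonneg (c := fun i => coeff (α i) f) (b := coeff β f)
      hsum hβ fun x _ => hev hf.1 x ▸ hf.2 x
    have hc := coeff_nonneg_of_sum_add_mul_prod_rpow_nonneg hlam h
    exact ⟨hc, neg_prod_div_rpow_le hlam hsum hc h⟩
  refine ⟨fun hβeven => Set.ext fun f => ⟨fun hf => ⟨hf.1, hnec hf⟩, ?_⟩,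
    fun hβodd => Set.ext fun f => ⟨fun hf => ⟨hf.1, (hnec hf).1, (hnec hf).2, ?_⟩, ?_⟩⟩
  · rintro ⟨hsupp, hc, hb⟩
    refine ⟨hsupp, fun x => ?_⟩
    rw [hev hsupp]
    have hpos : 0 ≤ ∏ j, x j ^ β j := Finset.prod_nonneg fun j _ => (hβeven j).pow_nonneg _
    have h := hamgm hc x
    rw [abs_of_nonneg hpos] at h
    nlinarith [mul_le_mul_of_nonneg_right hb hpos]
  · obtain ⟨j₀, hj₀⟩ := not_forall.1 hβodd
    have h := haff.sum_add_mul_prod_rpow_nonneg (c := fun i => coeff (α i) f) (b := -coeff β f)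
      hsum hβ fun x _ => by
        have hx := hf.2 (Function.update x j₀ (-x j₀))
        rw [hev hf.1, prod_update_neg_pow x β, (Nat.not_even_iff_odd.1 hj₀).neg_one_pow] at hx
        have hα (i : Fin (k + 1)) : ∏ j, Function.update x j₀ (-x j₀) j ^ α i j =
            ∏ j, x j ^ α i j := by
          rw [prod_update_neg_pow x (α i), (heven i j₀).neg_one_pow, one_mul]
        simp only [hα] at hx
        linarith
    exact neg_le_neg_iff.1 (neg_prod_div_rpow_le hlam hsum (hnec hf).1 h)
  · rintro ⟨hsupp, hc, hb, hb'⟩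
    refine ⟨hsupp, fun x => ?_⟩
    rw [hev hsupp]
    have h := mul_le_mul_of_nonneg_right (abs_le.2 ⟨hb, hb'⟩) (abs_nonneg (∏ j, x j ^ β j))
    rw [← abs_mul] at h
    linarith [hamgm hc x, neg_abs_le (coeff β f * ∏ j, x j ^ β j)]
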